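/- Let f : ℝ^{n_x} × ℝ^{n_y} → ℝ be twice continuously differentiable, let (x*, y*) satisfy ∇ₓf(x*, y*) = 0 and ∇ᵧf(x*, y*) = 0, assume ∇_{zz}f(x*, y*) and ∇_{yy}f(x*, y*) are invertible and ∇_{zz}f(·) is differentiable in a neighborhood of (x*, y*). If (x*, y*) is not a local minmax of min_x max_y f, then there exist functions ε_x, ε_y : ℝ^{n_x}×ℝ^{n_y} → [0, ∞), constant in a neighborhood of (x*, y*) and satisfying the LQAC at (x*, y*), such that (x*, y*) is an unstable equilibrium of the modified Newton iteration (x, y)⁺ = (x, y) − (∇_{zz}f(x, y) + E(x, y))⁻¹ (∇ₓf(x, y); ∇ᵧf(x, y)), where E(x, y) = diag(ε_x(x, y)·1_{n_x}, −ε_y(x, y)·1_{n_y}). -/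

import Mathlib

open Filter Topology Matrix

noncomputable section

variable {nx ny : ℕ}

/-- Partial derivative of `f(x,y)` in the `i`-th `x`-coordinate. -/
def pdX (f : EuclideanSpace ℝ (Fin nx) → EuclideanSpace ℝ (Fin ny) → ℝ)
    (x : EuclideanSpace ℝ (Fin nx)) (y : EuclideanSpace ℝ (Fin ny)) (i : Fin nx) : ℝ :=
  fderiv ℝ (fun x' => f x' y) x (EuclideanSpace.single i 1)

/-- Partial derivative of `f(x,y)` in the `j`-th `y`-coordinate. -/
def pdY (f : EuclideanSpace ℝ (Fin nx) → EuclideanSpace ℝ (Fin ny) → ℝ)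
    (x : EuclideanSpace ℝ (Fin nx)) (y : EuclideanSpace ℝ (Fin ny)) (j : Fin ny) : ℝ :=
  fderiv ℝ (fun y' => f x y') y (EuclideanSpace.single j 1)

/-- The block `∇ₓₓf(x,y)`. -/
def Hxx (f : EuclideanSpace ℝ (Fin nx) → EuclideanSpace ℝ (Fin ny) → ℝ)
    (x : EuclideanSpace ℝ (Fin nx)) (y : EuclideanSpace ℝ (Fin ny)) :
    Matrix (Fin nx) (Fin nx) ℝ :=
  Matrix.of fun i j => fderiv ℝ (fun x' => pdX f x' y j) x (EuclideanSpace.single i 1)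

/-- The block `∇ₓᵧf(x,y)`. -/
def Hxy (f : EuclideanSpace ℝ (Fin nx) → EuclideanSpace ℝ (Fin ny) → ℝ)
    (x : EuclideanSpace ℝ (Fin nx)) (y : EuclideanSpace ℝ (Fin ny)) :
    Matrix (Fin nx) (Fin ny) ℝ :=
  Matrix.of fun i j => fderiv ℝ (fun x' => pdY f x' y j) x (EuclideanSpace.single i 1)

/-- The block `∇ᵧₓf(x,y)`. -/
def Hyx (f : EuclideanSpace ℝ (Fin nx) → EuclideanSpace ℝ (Fin ny) → ℝ)
    (x : EuclideanSpace ℝ (Fin nx)) (y : EuclideanSpace ℝ (Fin ny)) :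
    Matrix (Fin ny) (Fin nx) ℝ :=
  Matrix.of fun j i => fderiv ℝ (fun y' => pdX f x y' i) y (EuclideanSpace.single j 1)

/-- The block `∇ᵧᵧf(x,y)`. -/
def Hyy (f : EuclideanSpace ℝ (Fin nx) → EuclideanSpace ℝ (Fin ny) → ℝ)
    (x : EuclideanSpace ℝ (Fin nx)) (y : EuclideanSpace ℝ (Fin ny)) :
    Matrix (Fin ny) (Fin ny) ℝ :=
  Matrix.of fun i j => fderiv ℝ (fun y' => pdY f x y' j) y (EuclideanSpace.single i 1)

/-- The full Hessian `∇_zz f(x,y) = [[∇ₓₓf, ∇ₓᵧf],[∇ᵧₓf, ∇ᵧᵧf]]`. -/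
def Hzz (f : EuclideanSpace ℝ (Fin nx) → EuclideanSpace ℝ (Fin ny) → ℝ)
    (x : EuclideanSpace ℝ (Fin nx)) (y : EuclideanSpace ℝ (Fin ny)) :
    Matrix (Fin nx ⊕ Fin ny) (Fin nx ⊕ Fin ny) ℝ :=
  Matrix.fromBlocks (Hxx f x y) (Hxy f x y) (Hyx f x y) (Hyy f x y)

/-- The real symmetric matrix `A` has inertia `t = (n₊, n₋, n₀)`. -/
def HasInertia {ι : Type*} [Fintype ι] [DecidableEq ι] (A : Matrix ι ι ℝ)
    (t : ℕ × ℕ × ℕ) : Prop :=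
  ∃ hA : A.IsHermitian,
    Nat.card {i // 0 < hA.eigenvalues i} = t.1 ∧
    Nat.card {i // hA.eigenvalues i < 0} = t.2.1 ∧
    Nat.card {i // hA.eigenvalues i = 0} = t.2.2

/-- `(xs, ys)` is a local minmax point of `min_x max_y f(x,y)`. -/
def IsLocalMinMax (f : EuclideanSpace ℝ (Fin nx) → EuclideanSpace ℝ (Fin ny) → ℝ)
    (xs : EuclideanSpace ℝ (Fin nx)) (ys : EuclideanSpace ℝ (Fin ny)) : Prop :=
  ∃ δ₀ > (0 : ℝ), ∃ h : ℝ → ℝ,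
    (∀ δ ∈ Set.Ioc (0 : ℝ) δ₀, 0 < h δ) ∧
    Tendsto h (𝓝[>] 0) (𝓝 0) ∧
    ∀ δ ∈ Set.Ioc (0 : ℝ) δ₀, ∀ x y, ‖x - xs‖ ≤ δ → ‖y - ys‖ ≤ h δ →
      f xs y ≤ f xs ys ∧ ∃ yt, ‖yt - ys‖ ≤ h δ ∧ f xs ys ≤ f x yt

/-- Lyapunov stability of a fixed point of the discrete iteration `z⁺ = T(z)`. -/
def StableFixedPt {Z : Type*} [NormedAddCommGroup Z] (T : Z → Z) (z : Z) : Prop :=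
  ∀ η > 0, ∃ δ > 0, ∀ z₀, ‖z₀ - z‖ < δ → ∀ k : ℕ, ‖T^[k] z₀ - z‖ < η

/-- An unstable fixed point: the Lyapunov stability property fails. -/
def IsUnstableFixedPt {Z : Type*} [NormedAddCommGroup Z] (T : Z → Z) (z : Z) : Prop :=
  Function.IsFixedPt T z ∧ ¬ StableFixedPt T z

/-- The modification matrix `E(x,y) = diag(ε_x·1_{n_x}, −ε_y·1_{n_y})`. -/
def Emod (nx ny : ℕ) (εx εy : ℝ) : Matrix (Fin nx ⊕ Fin ny) (Fin nx ⊕ Fin ny) ℝ :=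
  Matrix.diagonal (Sum.elim (fun _ => εx) (fun _ => -εy))

/-- The Local Quadratic Approximation Condition (LQAC) at `(x,y)`. -/
def LQAC (f : EuclideanSpace ℝ (Fin nx) → EuclideanSpace ℝ (Fin ny) → ℝ)
    (εx εy : EuclideanSpace ℝ (Fin nx) × EuclideanSpace ℝ (Fin ny) → ℝ)
    (p : EuclideanSpace ℝ (Fin nx) × EuclideanSpace ℝ (Fin ny)) : Prop :=
  HasInertia (Hyy f p.1 p.2 - εy p • (1 : Matrix (Fin ny) (Fin ny) ℝ)) (0, ny, 0) ∧
  HasInertia (Hzz f p.1 p.2 + Emod nx ny (εx p) (εy p)) (nx, ny, 0)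

/-- The modified Newton iteration for minmax:
`(x,y)⁺ = (x,y) − (∇_zz f + E)⁻¹ (∇ₓf; ∇ᵧf)`. -/
def newtonMinMaxMap (f : EuclideanSpace ℝ (Fin nx) → EuclideanSpace ℝ (Fin ny) → ℝ)
    (εx εy : EuclideanSpace ℝ (Fin nx) × EuclideanSpace ℝ (Fin ny) → ℝ)
    (p : EuclideanSpace ℝ (Fin nx) × EuclideanSpace ℝ (Fin ny)) :
    EuclideanSpace ℝ (Fin nx) × EuclideanSpace ℝ (Fin ny) :=
  let d : Fin nx ⊕ Fin ny → ℝ :=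
    (Hzz f p.1 p.2 + Emod nx ny (εx p) (εy p))⁻¹.mulVec
      (Sum.elim (fun i => pdX f p.1 p.2 i) (fun j => pdY f p.1 p.2 j))
  ((WithLp.equiv 2 (Fin nx → ℝ)).symm fun i => p.1 i - d (Sum.inl i),
    (WithLp.equiv 2 (Fin ny → ℝ)).symm fun j => p.2 j - d (Sum.inr j))

/-- A subspace on which `σ W` is negative definite meets the span of the eigenvectors with
`σ`-nonnegative eigenvalues trivially. -/
theorem card_eigenvalues_add_card_le {ι κ : Type*} [Fintype ι] [DecidableEq ι] [Fintype κ]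
    {W : Matrix ι ι ℝ} (hW : W.IsHermitian) (σ : ℝ) (L : (κ → ℝ) →ₗ[ℝ] (ι → ℝ))
    (hL : ∀ y, y ≠ 0 → σ * (L y ⬝ᵥ W *ᵥ L y) < 0) (s : ι → Prop)
    (hs : ∀ i, s i → 0 ≤ σ * hW.eigenvalues i) :
    Nat.card {i // s i} + Fintype.card κ ≤ Fintype.card ι := by
  classical
  set v : {i // s i} → ι → ℝ := fun i => WithLp.ofLp (hW.eigenvectorBasis i) with hv
  have horth : ∀ i j, v i ⬝ᵥ v j = if i = j then 1 else 0 := by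
    intro i j
    have h := orthonormal_iff_ite.mp hW.eigenvectorBasis.orthonormal (j : ι) (i : ι)
    rw [EuclideanSpace.inner_eq_star_dotProduct] at h
    simp only [star_trivial] at h
    rw [hv, h]
    simp only [Subtype.ext_iff, eq_comm]
  have hWv : ∀ i, W *ᵥ v i = hW.eigenvalues i • v i := fun i => hW.mulVec_eigenvectorBasis i
  let Φ : ({i // s i} → ℝ) × (κ → ℝ) →ₗ[ℝ] (ι → ℝ) :=
    (Fintype.linearCombination ℝ v).coprod (-L)
  have hinj : Function.Injective Φ := by
    rw [← LinearMap.ker_eq_bot, LinearMap.ker_eq_bot']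
    rintro ⟨c, y⟩ h
    have h1 : L y = ∑ i, c i • v i := by
      simp only [Φ, LinearMap.coprod_apply, Fintype.linearCombination_apply,
        LinearMap.neg_apply] at h
      exact (add_neg_eq_zero.mp h).symm
    have h2 : L y ⬝ᵥ W *ᵥ L y = ∑ i, c i ^ 2 * hW.eigenvalues i := by
      rw [h1, mulVec_sum, sum_dotProduct]
      refine Finset.sum_congr rfl fun i _ => ?_
      rw [dotProduct_sum, Finset.sum_eq_single i]
      · simp only [mulVec_smul, hWv, dotProduct_smul, smul_dotProduct, horth, smul_eq_mul, if_true]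
        ring
      · intro j _ hji
        simp [mulVec_smul, hWv, dotProduct_smul, smul_dotProduct, horth, hji.symm]
      · simp
    have hy : y = 0 := by
      by_contra hy
      have h3 := hL y hy
      rw [h2, Finset.mul_sum] at h3
      refine absurd h3 (not_lt.mpr (Finset.sum_nonneg fun i _ => ?_))
      have := mul_nonneg (sq_nonneg (c i)) (hs i i.2)
      linarith
    have hc : c = 0 := by
      funext j
      have h4 : v j ⬝ᵥ (∑ i, c i • v i) = 0 := by rw [← h1, hy]; simp
      rw [dotProduct_sum, Finset.sum_eq_single j] at h4
      · simpa [dotProduct_smul, horth] using h4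
      · intro i _ hij
        simp [dotProduct_smul, horth, hij.symm]
      · simp
    simp [hc, hy]
  have := LinearMap.finrank_le_finrank_of_injective hinj
  simpa [Module.finrank_prod] using this

theorem hasInertia_of_neg {n : ℕ} {D : Matrix (Fin n) (Fin n) ℝ} (hD : (-D).PosDef) :
    HasInertia D (0, n, 0) := by
  have hH : D.IsHermitian := by simpa using hD.isHermitian.neg
  have hneg : ∀ i, hH.eigenvalues i < 0 := by
    intro i
    have hv : WithLp.ofLp (hH.eigenvectorBasis i) ≠ 0 := by
      have := hH.eigenvectorBasis.toBasis.ne_zero i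
      simpa using this
    have h := hD.dotProduct_mulVec_pos hv
    rw [neg_mulVec, hH.mulVec_eigenvectorBasis] at h
    simp only [star_trivial, dotProduct_neg, dotProduct_smul, smul_eq_mul] at h
    have h2 := dotProduct_self_star_nonneg (WithLp.ofLp (hH.eigenvectorBasis i))
    simp only [star_trivial] at h2
    by_contra hc
    have := mul_nonneg (not_lt.mp hc) h2
    linarith
  refine ⟨hH, ?_, ?_, ?_⟩
  · have : IsEmpty {i // 0 < hH.eigenvalues i} := ⟨fun i => absurd i.2 (hneg i).not_gt⟩
    simp
  · simp [hneg]
  · simp [fun i => (hneg i).ne]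

theorem hasInertia_fromBlocks {m n : ℕ} {A : Matrix (Fin m) (Fin m) ℝ}
    {B : Matrix (Fin m) (Fin n) ℝ} {D : Matrix (Fin n) (Fin n) ℝ}
    (hA : A.PosDef) (hD : (-D).PosDef) :
    HasInertia (Matrix.fromBlocks A B Bᵀ D) (m, n, 0) := by
  have hDH : D.IsHermitian := by simpa using hD.isHermitian.neg
  have hW : (Matrix.fromBlocks A B Bᵀ D).IsHermitian :=
    hA.isHermitian.fromBlocks (by simp [conjTranspose_eq_transpose_of_trivial]) hDH
  let Lx : (Fin m → ℝ) →ₗ[ℝ] (Fin m ⊕ Fin n → ℝ) :=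
    { toFun := fun x => Sum.elim x 0
      map_add' := fun x y => by ext (i | i) <;> simp
      map_smul' := fun c x => by ext (i | i) <;> simp }
  let Ly : (Fin n → ℝ) →ₗ[ℝ] (Fin m ⊕ Fin n → ℝ) :=
    { toFun := fun x => Sum.elim 0 x
      map_add' := fun x y => by ext (i | i) <;> simp
      map_smul' := fun c x => by ext (i | i) <;> simp }
  have hpos := card_eigenvalues_add_card_le hW 1 Ly (fun y hy => by
    have := hD.dotProduct_mulVec_pos hy
    simp only [star_trivial, neg_mulVec, dotProduct_neg] at this
    simpa [Ly, fromBlocks_mulVec, sumElim_dotProduct_sumElim] using this)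
    (fun i => 0 ≤ hW.eigenvalues i) (by simp)
  have hneg := card_eigenvalues_add_card_le hW (-1) Lx (fun y hy => by
    have := hA.dotProduct_mulVec_pos hy
    simp only [star_trivial] at this
    simpa [Lx, fromBlocks_mulVec, sumElim_dotProduct_sumElim] using this)
    (fun i => hW.eigenvalues i ≤ 0) (by simp)
  simp only [Nat.card_eq_fintype_card, Fintype.card_subtype, Fintype.card_sum,
    Fintype.card_fin] at hpos hneg
  have e1 : Finset.univ.filter (fun i => 0 ≤ hW.eigenvalues i) =
      Finset.univ.filter (fun i => 0 < hW.eigenvalues i) ∪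
      Finset.univ.filter (fun i => hW.eigenvalues i = 0) := by
    ext i; simp [le_iff_lt_or_eq, eq_comm]
  have e2 : Finset.univ.filter (fun i => hW.eigenvalues i ≤ 0) =
      Finset.univ.filter (fun i => hW.eigenvalues i < 0) ∪
      Finset.univ.filter (fun i => hW.eigenvalues i = 0) := by
    ext i; simp [le_iff_lt_or_eq]
  have e3 : (Finset.univ : Finset (Fin m ⊕ Fin n)) =
      Finset.univ.filter (fun i => 0 ≤ hW.eigenvalues i) ∪
      Finset.univ.filter (fun i => hW.eigenvalues i < 0) := by
    ext i; simp [le_or_gt]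
  have c1 := congrArg Finset.card e1
  have c2 := congrArg Finset.card e2
  have c3 := congrArg Finset.card e3
  rw [Finset.card_union_of_disjoint
    (Finset.disjoint_filter.mpr fun i _ h => by linarith)] at c1 c2
  rw [Finset.card_union_of_disjoint
    (Finset.disjoint_filter.mpr fun i _ h => by linarith)] at c3
  simp only [Finset.card_univ, Fintype.card_sum, Fintype.card_fin] at c3
  refine ⟨hW, ?_, ?_, ?_⟩ <;> simp only [Nat.card_eq_fintype_card, Fintype.card_subtype] <;> omega

theorem exists_dotProduct_mulVec_le {m n : Type*} [Fintype m] [Fintype n] (M : Matrix m n ℝ) :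
    ∃ C > 0, ∀ x y, |x ⬝ᵥ M *ᵥ y| ≤ C * (x ⬝ᵥ x + y ⬝ᵥ y) := by
  refine ⟨∑ i, ∑ j, |M i j| + 1, by positivity, fun x y => ?_⟩
  have hx : ∀ i, x i ^ 2 ≤ x ⬝ᵥ x := fun i => by
    rw [dotProduct, pow_two]
    exact Finset.single_le_sum (f := fun i => x i * x i) (fun j _ => mul_self_nonneg _)
      (Finset.mem_univ i)
  have hy : ∀ i, y i ^ 2 ≤ y ⬝ᵥ y := fun i => by
    rw [dotProduct, pow_two]
    exact Finset.single_le_sum (f := fun i => y i * y i) (fun j _ => mul_self_nonneg _)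
      (Finset.mem_univ i)
  have hx0 : 0 ≤ x ⬝ᵥ x := by simpa using dotProduct_self_star_nonneg x
  have hy0 : 0 ≤ y ⬝ᵥ y := by simpa using dotProduct_self_star_nonneg y
  have hterm : ∀ i j, |x i * (M i j * y j)| ≤ |M i j| * (x ⬝ᵥ x + y ⬝ᵥ y) := by
    intro i j
    have h1 : |x i * (M i j * y j)| = |M i j| * (|x i| * |y j|) := by
      simp only [abs_mul]; ring
    rw [h1]
    refine mul_le_mul_of_nonneg_left ?_ (abs_nonneg _)
    nlinarith [hx i, hy j, sq_abs (x i), sq_abs (y j), sq_nonneg (|x i| - |y j|),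
      sq_nonneg (|x i| + |y j|)]
  calc |x ⬝ᵥ M *ᵥ y| = |∑ i, ∑ j, x i * (M i j * y j)| := by
        simp only [dotProduct, mulVec, Finset.mul_sum]
    _ ≤ ∑ i, ∑ j, |M i j| * (x ⬝ᵥ x + y ⬝ᵥ y) :=
        (Finset.abs_sum_le_sum_abs _ _).trans (Finset.sum_le_sum fun i _ =>
          (Finset.abs_sum_le_sum_abs _ _).trans (Finset.sum_le_sum fun j _ => hterm i j))
    _ ≤ _ := by
        simp only [← Finset.sum_mul]
        nlinarith

theorem exists_dotProduct_mulVec_le_of_pos {m n : Type*} [Fintype m] [Fintype n]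
    (M : Matrix m n ℝ) {δ : ℝ} (hδ : 0 < δ) :
    ∃ C > 0, ∀ x y, |x ⬝ᵥ M *ᵥ y| ≤ δ * (x ⬝ᵥ x) + C * (y ⬝ᵥ y) := by
  obtain ⟨C, hC, h⟩ := exists_dotProduct_mulVec_le M
  refine ⟨C ^ 2 / δ, by positivity, fun x y => ?_⟩
  have h1 := h ((δ / C) • x) y
  have hs : 0 < δ / C := by positivity
  rw [smul_dotProduct, smul_dotProduct, dotProduct_smul, smul_eq_mul, smul_eq_mul, smul_eq_mul,
    abs_mul, abs_of_pos hs, ← le_div_iff₀' hs] at h1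
  refine h1.trans_eq ?_
  field_simp

theorem dotProduct_self_pos {n : Type*} [Fintype n] {x : n → ℝ} (hx : x ≠ 0) : 0 < x ⬝ᵥ x := by
  simpa using dotProduct_self_star_pos_iff.mpr hx

theorem dotProduct_self_nonneg {n : Type*} [Fintype n] (x : n → ℝ) : 0 ≤ x ⬝ᵥ x := by
  simpa using dotProduct_self_star_nonneg x

theorem exists_posDef_add_smul_one {n : Type*} [Fintype n] [DecidableEq n] {A : Matrix n n ℝ}
    (hA : A.IsHermitian) : ∃ c₀ > (0 : ℝ), ∀ c > c₀, (A + c • (1 : Matrix n n ℝ)).PosDef := by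
  obtain ⟨C, hC, h⟩ := exists_dotProduct_mulVec_le A
  refine ⟨2 * C, by positivity, fun c hc => PosDef.of_dotProduct_mulVec_pos ?_ ?_⟩
  · exact hA.add ((isHermitian_one).smul (by simp [IsSelfAdjoint]))
  · intro x hx
    have h1 := dotProduct_self_pos hx
    have h2 := (abs_le.mp (h x x)).1
    simp only [star_trivial, add_mulVec, smul_mulVec, one_mulVec, dotProduct_add,
      dotProduct_smul, smul_eq_mul]
    nlinarith

theorem exists_le_dotProduct_mulVec_self {n : Type*} [Fintype n] [DecidableEq n]
    {P : Matrix n n ℝ} (hP : IsUnit P.det) :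
    ∃ γ > 0, ∀ x, γ * (x ⬝ᵥ x) ≤ P *ᵥ x ⬝ᵥ P *ᵥ x := by
  obtain ⟨C, hC, h⟩ := exists_dotProduct_mulVec_le (P⁻¹ᵀ * P⁻¹)
  refine ⟨(2 * C)⁻¹, by positivity, fun x => ?_⟩
  have h1 := (abs_le.mp (h (P *ᵥ x) (P *ᵥ x))).2
  rw [← mulVec_mulVec, dotProduct_mulVec, ← mulVec_transpose, transpose_transpose,
    mulVec_mulVec, nonsing_inv_mul _ hP, one_mulVec] at h1
  rw [inv_mul_le_iff₀ (by positivity)]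
  linarith

theorem exists_isUnit_det_one_sub_smul {n : Type*} [Fintype n] [DecidableEq n]
    (G : Matrix n n ℝ) {r : ℝ} (hr : r < 1) :
    ∃ q > 1, q * r < 1 ∧ IsUnit (1 - q • G).det := by
  obtain ⟨b, hb, hbr⟩ : ∃ b > 1, ∀ q, 1 < q → q < b → q * r < 1 := by
    rcases le_or_gt r 0 with h | h
    · exact ⟨2, by norm_num, fun q h1 _ => by nlinarith⟩
    · refine ⟨r⁻¹, (one_lt_inv₀ h).mpr hr, fun q _ h2 => ?_⟩
      rwa [← lt_div_iff₀ h, one_div]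
  have hfin : {q : ℝ | q⁻¹ ∈ spectrum ℝ G}.Finite :=
    (Matrix.finite_spectrum G).preimage inv_injective.injOn
  obtain ⟨q, hq, hqs⟩ := (Set.Ioo_infinite hb).exists_notMem_finite hfin
  refine ⟨q, hq.1, hbr q hq.1 hq.2, ?_⟩
  have hq0 : q ≠ 0 := by linarith [hq.1]
  simp only [Set.mem_ofPred_eq, spectrum.mem_iff, not_not, Algebra.algebraMap_eq_smul_one] at hqs
  have : 1 - q • G = q • (q⁻¹ • (1 : Matrix n n ℝ) - G) := by
    rw [smul_sub, smul_smul, mul_inv_cancel₀ hq0, one_smul]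
  rw [this, det_smul]
  exact ((isUnit_iff_ne_zero.mpr hq0).pow _).mul ((isUnit_iff_isUnit_det _).mp hqs)

theorem dotProduct_mulVec_comm_of_isHermitian {n : Type*} [Fintype n] {F : Matrix n n ℝ}
    (hF : F.IsHermitian) (x y : n → ℝ) : F *ᵥ x ⬝ᵥ y = x ⬝ᵥ F *ᵥ y := by
  rw [dotProduct_mulVec, ← mulVec_transpose]
  rw [← conjTranspose_eq_transpose_of_trivial, hF.eq]

/-- If the symmetric matrix `F` contracts an eigenvector, some quadratic form which is positive
at that eigenvector satisfies a strict Stein inequality with respect to `F`. -/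
theorem exists_stein_form {n : Type*} [Fintype n] [DecidableEq n] {F : Matrix n n ℝ}
    (hF : F.IsHermitian) {v : n → ℝ} (hv : v ≠ 0) {r : ℝ} (hFv : F *ᵥ v = r • v)
    (hr : r ^ 2 < 1) :
    ∃ q > 1, ∃ P : Matrix n n ℝ, P.IsHermitian ∧ 0 < v ⬝ᵥ P *ᵥ v ∧
      ∃ γ > 0, ∀ w, γ * (w ⬝ᵥ w) ≤ w ⬝ᵥ P *ᵥ w - q * (F *ᵥ w ⬝ᵥ P *ᵥ F *ᵥ w) := by
  obtain ⟨q, hq, hqr, hu⟩ := exists_isUnit_det_one_sub_smul (F * F) hr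
  have hP : (1 - q • (F * F)).IsHermitian := by
    refine isHermitian_one.sub (IsHermitian.smul ?_ (by simp [IsSelfAdjoint]))
    rw [IsHermitian, conjTranspose_mul, hF.eq]
  obtain ⟨γ, hγ, h⟩ := exists_le_dotProduct_mulVec_self hu
  refine ⟨q, hq, _, hP, ?_, γ, hγ, fun w => (h w).trans_eq ?_⟩
  · simp only [sub_mulVec, one_mulVec, smul_mulVec, ← mulVec_mulVec, hFv, mulVec_smul,
      dotProduct_sub, dotProduct_smul, smul_eq_mul]
    nlinarith [dotProduct_self_pos hv]
  · simp only [sub_mulVec, one_mulVec, smul_mulVec, ← mulVec_mulVec, mulVec_sub, mulVec_smul,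
      dotProduct_sub, sub_dotProduct, dotProduct_smul, smul_dotProduct, smul_eq_mul,
      dotProduct_mulVec_comm_of_isHermitian hF]

/-- There are shifts `c, e` such that the linearised modified Newton step `z ↦ w` expands a
block-diagonal quadratic form that takes positive values. -/
def HasExpandingForm {m n : ℕ} (A : Matrix (Fin m) (Fin m) ℝ) (B : Matrix (Fin m) (Fin n) ℝ)
    (D : Matrix (Fin n) (Fin n) ℝ) : Prop :=
  ∃ c ≥ (0 : ℝ), ∃ e ≥ (0 : ℝ), (A + c • (1 : Matrix (Fin m) (Fin m) ℝ)).PosDef ∧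
    (-(D - e • (1 : Matrix (Fin n) (Fin n) ℝ))).PosDef ∧
    ∃ q > 1, ∃ (P₁ : Matrix (Fin m) (Fin m) ℝ) (P₂ : Matrix (Fin n) (Fin n) ℝ),
      (∃ z₁ z₂, 0 < z₁ ⬝ᵥ P₁ *ᵥ z₁ + z₂ ⬝ᵥ P₂ *ᵥ z₂) ∧
      ∀ z₁ z₂ w₁ w₂, A *ᵥ w₁ + c • w₁ + B *ᵥ w₂ = c • z₁ →
        Bᵀ *ᵥ w₁ + D *ᵥ w₂ - e • w₂ = -(e • z₂) → ¬ (z₁ = 0 ∧ z₂ = 0) →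
        q * (z₁ ⬝ᵥ P₁ *ᵥ z₁ + z₂ ⬝ᵥ P₂ *ᵥ z₂) < w₁ ⬝ᵥ P₁ *ᵥ w₁ + w₂ ⬝ᵥ P₂ *ᵥ w₂

theorem hasExpandingForm_of_schur {m n : ℕ} {A : Matrix (Fin m) (Fin m) ℝ}
    {B : Matrix (Fin m) (Fin n) ℝ} {D : Matrix (Fin n) (Fin n) ℝ} (hA : A.IsHermitian)
    (hD : (-D).PosDef) {v : Fin m → ℝ} (hv : v ≠ 0) {μ : ℝ} (hμ : μ < 0)
    (hSv : (A - B * D⁻¹ * Bᵀ) *ᵥ v = μ • v) : HasExpandingForm A B D := by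
  have hDH : D.IsHermitian := by simpa using hD.isHermitian.neg
  have hDu : IsUnit D.det := by
    have := (isUnit_iff_isUnit_det _).mp hD.isUnit
    rw [det_neg] at this
    exact isUnit_of_mul_isUnit_right this
  have hDT : Dᵀ = D := by rw [← conjTranspose_eq_transpose_of_trivial, hDH.eq]
  have hS : (A - B * D⁻¹ * Bᵀ).IsHermitian := by
    refine hA.sub ?_
    rw [IsHermitian]
    simp only [conjTranspose_eq_transpose_of_trivial, transpose_mul, transpose_transpose,
      transpose_nonsing_inv, hDT, Matrix.mul_assoc]
  set S := A - B * D⁻¹ * Bᵀ with hSdef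
  obtain ⟨c₀, hc₀, hc⟩ := exists_posDef_add_smul_one hA
  obtain ⟨c, hcc, hcμ⟩ : ∃ c > c₀, -μ < c :=
    ⟨max c₀ (-μ) + 1, by linarith [le_max_left c₀ (-μ)], by linarith [le_max_right c₀ (-μ)]⟩
  have hcpos : 0 < c := hc₀.trans hcc
  have hF : (1 + c⁻¹ • S).IsHermitian :=
    isHermitian_one.add (hS.smul (by simp [IsSelfAdjoint]))
  have hFv : (1 + c⁻¹ • S) *ᵥ v = (1 + c⁻¹ * μ) • v := by
    rw [add_mulVec, one_mulVec, smul_mulVec, hSv, add_smul, one_smul, smul_smul]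
  have hr : (1 + c⁻¹ * μ) ^ 2 < 1 := by
    have h1 : c⁻¹ * μ < 0 := mul_neg_of_pos_of_neg (by positivity) hμ
    have h2 : -1 < c⁻¹ * μ := by
      rw [inv_mul_eq_div, lt_div_iff₀ hcpos]; linarith
    nlinarith
  obtain ⟨q, hq, P, -, hvP, γ, hγ, h⟩ := exists_stein_form hF hv hFv hr
  obtain ⟨C, hC, hL⟩ := exists_dotProduct_mulVec_le ((D⁻¹ * Bᵀ)ᵀ * (D⁻¹ * Bᵀ))
  have hk : 0 < γ / (4 * C) := by positivity
  set k := γ / (4 * C) with hkdef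
  have hkC : k * (2 * C) = γ / 2 := by rw [hkdef]; field_simp; norm_num
  refine ⟨c, hcpos.le, 0, le_rfl, hc c hcc, by simpa using hD, q, hq, P, -(k • 1),
    ⟨v, 0, by simpa using hvP⟩, ?_⟩
  intro z₁ z₂ w₁ w₂ e1 e2 hz
  have hw₂ : w₂ = -((D⁻¹ * Bᵀ) *ᵥ w₁) := by
    have e3 : D *ᵥ w₂ = -(Bᵀ *ᵥ w₁) := by
      simp only [zero_smul, sub_zero, neg_zero] at e2
      exact (neg_eq_of_add_eq_zero_right e2).symm
    have := congrArg (D⁻¹ *ᵥ ·) e3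
    simpa [mulVec_mulVec, nonsing_inv_mul _ hDu, mulVec_neg] using this
  have hz₁ : z₁ = (1 + c⁻¹ • S) *ᵥ w₁ := by
    have h1 : z₁ = c⁻¹ • (c • z₁) := by rw [smul_smul, inv_mul_cancel₀ hcpos.ne', one_smul]
    rw [h1, ← e1, hw₂, hSdef]
    simp only [add_mulVec, one_mulVec, smul_mulVec, sub_mulVec, mulVec_neg, smul_add, smul_smul,
      inv_mul_cancel₀ hcpos.ne', one_smul, smul_sub, mulVec_mulVec, Matrix.mul_assoc, smul_neg]
    abel
  have h1 := h w₁
  rw [← hz₁] at h1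
  have h2 : w₂ ⬝ᵥ w₂ ≤ 2 * C * (w₁ ⬝ᵥ w₁) := by
    have h3 := (abs_le.mp (hL w₁ w₁)).2
    rw [← mulVec_mulVec, dotProduct_mulVec, ← mulVec_transpose, transpose_transpose] at h3
    rw [hw₂]
    simp only [dotProduct_neg, neg_dotProduct, neg_neg]
    linarith
  simp only [neg_mulVec, smul_mulVec, one_mulVec, dotProduct_neg, dotProduct_smul, smul_eq_mul]
  have h3 : k * (w₂ ⬝ᵥ w₂) ≤ γ / 2 * (w₁ ⬝ᵥ w₁) := by
    have := mul_le_mul_of_nonneg_left h2 hk.le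
    rw [← mul_assoc, hkC] at this
    exact this
  have h4 : 0 < γ / 2 * (w₁ ⬝ᵥ w₁) + q * (k * (z₂ ⬝ᵥ z₂)) := by
    by_cases hw : w₁ = 0
    · have hz₂ : z₂ ≠ 0 := fun h0 => hz ⟨by rw [hz₁, hw, mulVec_zero], h0⟩
      have := dotProduct_self_pos hz₂
      rw [hw, dotProduct_zero, mul_zero, zero_add]
      positivity
    · have := dotProduct_self_pos hw
      have := dotProduct_self_nonneg z₂
      positivity
  linarith

set_option maxHeartbeats 800000 in
theorem hasExpandingForm_of_eigenvalue_pos {m n : ℕ} {A : Matrix (Fin m) (Fin m) ℝ}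
    {B : Matrix (Fin m) (Fin n) ℝ} {D : Matrix (Fin n) (Fin n) ℝ} (hA : A.IsHermitian)
    (hD : D.IsHermitian) {v : Fin n → ℝ} (hv : v ≠ 0) {d : ℝ} (hd : 0 < d)
    (hDv : D *ᵥ v = d • v) : HasExpandingForm A B D := by
  obtain ⟨e₀, he₀, he⟩ := exists_posDef_add_smul_one hD.neg
  obtain ⟨e, hee, hed⟩ : ∃ e > e₀, d < e :=
    ⟨max e₀ d + 1, by linarith [le_max_left e₀ d], by linarith [le_max_right e₀ d]⟩
  have hepos : 0 < e := he₀.trans hee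
  have hF : (1 - e⁻¹ • D).IsHermitian :=
    isHermitian_one.sub (hD.smul (by simp [IsSelfAdjoint]))
  have hFv : (1 - e⁻¹ • D) *ᵥ v = (1 - e⁻¹ * d) • v := by
    rw [sub_mulVec, one_mulVec, smul_mulVec, hDv, sub_smul, one_smul, smul_smul]
  have hr : (1 - e⁻¹ * d) ^ 2 < 1 := by
    have h1 : 0 < e⁻¹ * d := by positivity
    have h2 : e⁻¹ * d < 1 := by
      rw [inv_mul_eq_div, div_lt_iff₀ hepos]; linarith
    nlinarith
  obtain ⟨q, hq, P, hP, hvP, γ, hγ, h⟩ := exists_stein_form hF hv hFv hr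
  set F := 1 - e⁻¹ • D with hFdef
  set M := e⁻¹ • Bᵀ with hM
  obtain ⟨C₁, hC₁, h₁⟩ := exists_dotProduct_mulVec_le_of_pos (F * P * M)
    (show 0 < γ / (4 * q) by positivity)
  obtain ⟨C₂, hC₂, h₂⟩ := exists_dotProduct_mulVec_le (Mᵀ * P * M)
  obtain ⟨C₃, hC₃, h₃⟩ := exists_dotProduct_mulVec_le A
  obtain ⟨C₄, hC₄, h₄⟩ := exists_dotProduct_mulVec_le B
  obtain ⟨c₀, hc₀, hc⟩ := exists_posDef_add_smul_one hA
  have hq1 : 0 < q - 1 := by linarith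
  set k := (2 * q * C₁ + 2 * q * C₂ + 1) / (q - 1) with hk
  have hkpos : 0 < k := by positivity
  have hkq : q * k - k = 2 * q * C₁ + 2 * q * C₂ + 1 := by
    rw [hk]; field_simp
  obtain ⟨ε, hε, hε1, hε2⟩ : ∃ ε > 0, ε < γ / 2 ∧ ε < 1 :=
    ⟨min (γ / 4) (1 / 2), by positivity, (min_le_left _ _).trans_lt (by linarith),
      (min_le_right _ _).trans_lt (by norm_num)⟩
  set C₅ := q * k * (4 * C₃ + 2 * C₄) with hC₅
  obtain ⟨c, hcc, hcε⟩ : ∃ c > c₀, C₅ / ε < c :=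
    ⟨max c₀ (C₅ / ε) + 1, by linarith [le_max_left c₀ (C₅ / ε)],
      by linarith [le_max_right c₀ (C₅ / ε)]⟩
  have hcpos : 0 < c := hc₀.trans hcc
  have hsmall : c⁻¹ * C₅ ≤ ε := by
    rw [inv_mul_le_iff₀ hcpos]
    exact ((div_lt_iff₀ hε).mp hcε).le
  refine ⟨c, hcpos.le, e, hepos.le, hc c hcc, ?_, q, hq, -(k • 1), P,
    ⟨0, v, by simpa using hvP⟩, ?_⟩
  · rw [neg_sub, sub_eq_neg_add]
    exact he e hee
  intro z₁ z₂ w₁ w₂ e1 e2 hz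
  have hz₁ : z₁ = w₁ + c⁻¹ • (A *ᵥ w₁ + B *ᵥ w₂) := by
    have h0 : z₁ = c⁻¹ • (c • z₁) := by rw [smul_smul, inv_mul_cancel₀ hcpos.ne', one_smul]
    rw [h0, ← e1]
    simp only [smul_add, smul_smul, inv_mul_cancel₀ hcpos.ne', one_smul]
    abel
  have hz₂ : z₂ = F *ᵥ w₂ - M *ᵥ w₁ := by
    have h0 : z₂ = -(e⁻¹ • (-(e • z₂))) := by
      rw [smul_neg, neg_neg, smul_smul, inv_mul_cancel₀ hepos.ne', one_smul]
    rw [h0, ← e2, hFdef, hM]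
    simp only [smul_add, smul_sub, smul_smul, inv_mul_cancel₀ hepos.ne', one_smul, sub_mulVec,
      one_mulVec, smul_mulVec]
    abel
  have hw : 0 < w₁ ⬝ᵥ w₁ + w₂ ⬝ᵥ w₂ := by
    by_cases h0 : w₁ = 0
    · have : w₂ ≠ 0 := by
        rintro rfl
        exact hz ⟨by simp [hz₁, h0], by simp [hz₂, h0]⟩
      linarith [dotProduct_self_pos this, dotProduct_self_nonneg w₁]
    · linarith [dotProduct_self_pos h0, dotProduct_self_nonneg w₂]
  have b₁ := (abs_le.mp (h₁ w₂ w₁)).1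
  have b₂ := (abs_le.mp (h₂ w₁ w₁)).2
  have b₃ := (abs_le.mp (h₃ w₁ w₁)).1
  have b₄ := (abs_le.mp (h₄ w₁ w₂)).1
  have b := h w₂
  have hquad : z₂ ⬝ᵥ P *ᵥ z₂ = F *ᵥ w₂ ⬝ᵥ P *ᵥ F *ᵥ w₂ - 2 * (w₂ ⬝ᵥ (F * P * M) *ᵥ w₁)
      + w₁ ⬝ᵥ (Mᵀ * P * M) *ᵥ w₁ := by
    have t1 : w₁ ⬝ᵥ (Mᵀ * P * M) *ᵥ w₁ = M *ᵥ w₁ ⬝ᵥ P *ᵥ M *ᵥ w₁ := by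
      rw [← mulVec_mulVec, ← mulVec_mulVec, dotProduct_mulVec w₁ Mᵀ, ← mulVec_transpose,
        transpose_transpose]
    have t2 : w₂ ⬝ᵥ (F * P * M) *ᵥ w₁ = F *ᵥ w₂ ⬝ᵥ P *ᵥ M *ᵥ w₁ := by
      rw [dotProduct_mulVec_comm_of_isHermitian hF, ← mulVec_mulVec, ← mulVec_mulVec]
    have t3 : M *ᵥ w₁ ⬝ᵥ P *ᵥ F *ᵥ w₂ = F *ᵥ w₂ ⬝ᵥ P *ᵥ M *ᵥ w₁ := by
      rw [← dotProduct_mulVec_comm_of_isHermitian hP, dotProduct_comm]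
    rw [t1, t2, hz₂]
    simp only [mulVec_sub, dotProduct_sub, sub_dotProduct, t3]
    ring
  have hz₁z₁ : w₁ ⬝ᵥ w₁ + 2 * c⁻¹ * (w₁ ⬝ᵥ A *ᵥ w₁ + w₁ ⬝ᵥ B *ᵥ w₂) ≤ z₁ ⬝ᵥ z₁ := by
    have h0 := dotProduct_self_nonneg (c⁻¹ • (A *ᵥ w₁ + B *ᵥ w₂))
    have h0' : z₁ ⬝ᵥ z₁ = w₁ ⬝ᵥ w₁ + 2 * c⁻¹ * (w₁ ⬝ᵥ A *ᵥ w₁ + w₁ ⬝ᵥ B *ᵥ w₂) +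
        c⁻¹ • (A *ᵥ w₁ + B *ᵥ w₂) ⬝ᵥ c⁻¹ • (A *ᵥ w₁ + B *ᵥ w₂) := by
      rw [hz₁, add_dotProduct, dotProduct_add, dotProduct_add,
        dotProduct_comm (c⁻¹ • (A *ᵥ w₁ + B *ᵥ w₂)) w₁, dotProduct_smul, dotProduct_add,
        smul_eq_mul]
      ring
    linarith
  have hp₁ := dotProduct_self_nonneg w₁
  have hp₂ := dotProduct_self_nonneg w₂
  simp only [neg_mulVec, smul_mulVec, one_mulVec, dotProduct_neg, dotProduct_smul, smul_eq_mul]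
  rw [hquad]
  generalize w₁ ⬝ᵥ w₁ = X at *
  generalize w₂ ⬝ᵥ w₂ = Y at *
  generalize z₁ ⬝ᵥ z₁ = Z at *
  have k₁ : q * k * X - ε * (X + Y) ≤ q * k * Z := by
    have i₁ : X - c⁻¹ * (4 * C₃ + 2 * C₄) * (X + Y) ≤ Z := by
      have hci : 0 < c⁻¹ := by positivity
      have : -((4 * C₃ + 2 * C₄) * (X + Y)) ≤ 2 * (w₁ ⬝ᵥ A *ᵥ w₁ + w₁ ⬝ᵥ B *ᵥ w₂) := by
        linarith [mul_nonneg hC₃.le hp₂]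
      have := mul_le_mul_of_nonneg_left this hci.le
      linarith
    have i₂ := mul_le_mul_of_nonneg_left i₁ (show 0 ≤ q * k by positivity)
    have i₃ := mul_le_mul_of_nonneg_right hsmall hw.le
    have i₄ : q * k * (c⁻¹ * (4 * C₃ + 2 * C₄) * (X + Y)) = c⁻¹ * C₅ * (X + Y) := by
      rw [hC₅]; ring
    linarith
  have k₂ : q * (w₂ ⬝ᵥ (F * P * M) *ᵥ w₁) ≥ -(γ / 4 * Y + q * C₁ * X) := by
    have := mul_le_mul_of_nonneg_left b₁ (show 0 ≤ q by linarith)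
    have h0 : q * -(γ / (4 * q) * Y + C₁ * X) = -(γ / 4 * Y + q * C₁ * X) := by
      field_simp
    linarith
  have k₃ : q * (w₁ ⬝ᵥ (Mᵀ * P * M) *ᵥ w₁) ≤ 2 * q * C₂ * X := by
    have := mul_le_mul_of_nonneg_left b₂ (show 0 ≤ q by linarith)
    linarith
  have k₄ : q * k * X - k * X = (2 * q * C₁ + 2 * q * C₂ + 1) * X := by rw [← hkq]; ring
  have k₅ : ε * (X + Y) < X + γ / 2 * Y := by
    have i₁ := mul_nonneg (sub_nonneg.mpr hε2.le) hp₁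
    have i₂ := mul_nonneg (sub_nonneg.mpr hε1.le) hp₂
    rcases hp₁.eq_or_lt with h0 | h0
    · rw [← h0, zero_add] at hw
      linarith [mul_pos (sub_pos.mpr hε1) hw]
    · linarith [mul_pos (sub_pos.mpr hε2) h0]
  linarith

theorem not_stableFixedPt_of_expanding_form {Z : Type*} [NormedAddCommGroup Z] [NormedSpace ℝ Z]
    [FiniteDimensional ℝ Z] {T : Z → Z} {z : Z} {J : Z →L[ℝ] Z} (hT : HasFDerivAt T J z)
    (hz : T z = z) {Q : Z → ℝ} (hQc : Continuous Q) (hQh : ∀ (t : ℝ) v, Q (t • v) = t ^ 2 * Q v)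
    {q : ℝ} (hq : 1 < q) (hJ : ∀ d, d ≠ 0 → q * Q d < Q (J d)) (hpos : ∃ v, 0 < Q v) :
    ¬ StableFixedPt T z := by
  have hQ0 : Q 0 = 0 := by simpa using hQh 0 0
  obtain ⟨ε, hε, hcone⟩ : ∃ ε > 0, ∀ d w, ‖w - J d‖ ≤ ε * ‖d‖ → q * Q d ≤ Q w := by
    have hK : IsCompact ((fun d => (d, J d)) '' Metric.sphere (0 : Z) 1) :=
      (isCompact_sphere 0 1).image (by fun_prop)
    have hU : IsOpen {p : Z × Z | q * Q p.1 < Q p.2} :=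
      isOpen_lt (by fun_prop) (by fun_prop)
    obtain ⟨ε, hε, hsub⟩ := hK.exists_thickening_subset_open hU (by
      rintro _ ⟨d, hd, rfl⟩
      exact hJ d (by rintro rfl; simp at hd))
    refine ⟨ε / 2, by positivity, fun d w hdw => ?_⟩
    by_cases hd : d = 0
    · have : w = 0 := by simpa [hd] using hdw
      simp [hd, this, hQ0]
    · have hn : 0 < ‖d‖ := norm_pos_iff.mpr hd
      have hmem : ((‖d‖⁻¹ • d, ‖d‖⁻¹ • w) : Z × Z) ∈
          Metric.thickening ε ((fun d => (d, J d)) '' Metric.sphere (0 : Z) 1) := by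
        rw [Metric.mem_thickening_iff]
        refine ⟨_, ⟨‖d‖⁻¹ • d, by simp [norm_smul, hn.ne'], rfl⟩, ?_⟩
        rw [Prod.dist_eq, dist_self, dist_eq_norm]
        dsimp only
        rw [map_smul, ← smul_sub, norm_smul, norm_inv,
          norm_norm]
        refine max_lt hε ?_
        rw [inv_mul_lt_iff₀ hn]
        nlinarith
      have h := hsub hmem
      simp only [Set.mem_ofPred_eq, hQh] at h
      have h2 : 0 < (‖d‖⁻¹) ^ 2 := by positivity
      rw [mul_left_comm] at h
      exact (lt_of_mul_lt_mul_left h h2.le).le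
  have hev : ∀ᶠ u in 𝓝 z, q * Q (u - z) ≤ Q (T u - z) := by
    filter_upwards [hT.isLittleO.def hε] with u hu
    exact hcone _ _ (by rwa [hz] at hu)
  have hbd : ∀ᶠ u in 𝓝 z, Q (u - z) < 1 := by
    have : ContinuousAt (fun u => Q (u - z)) z := by fun_prop
    exact this.eventually_lt continuousAt_const (by simp [hQ0])
  obtain ⟨η, hη, hball⟩ := Metric.eventually_nhds_iff.mp (hev.and hbd)
  intro hstab
  obtain ⟨δ, hδ, hst⟩ := hstab η hη
  obtain ⟨v, hv⟩ := hpos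
  obtain ⟨t, ht, htv⟩ : ∃ t : ℝ, 0 < t ∧ ‖t • v‖ < δ := by
    refine ⟨δ / (2 * (‖v‖ + 1)), by positivity, ?_⟩
    rw [norm_smul, Real.norm_of_nonneg (by positivity), div_mul_eq_mul_div,
      div_lt_iff₀ (by positivity)]
    nlinarith [norm_nonneg v]
  have hst' := hst (z + t • v) (by simpa using htv)
  have hQ1 : 0 < Q (t • v) := by rw [hQh]; positivity
  have hgrow : ∀ k, q ^ k * Q (t • v) ≤ Q (T^[k] (z + t • v) - z) := by
    intro k
    induction k with
    | zero => simp
    | succ k ih =>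
      rw [Function.iterate_succ_apply', pow_succ', mul_assoc]
      refine (mul_le_mul_of_nonneg_left ih (by linarith)).trans ?_
      exact (hball (by simpa [dist_eq_norm] using hst' k)).1
  obtain ⟨k, hk⟩ := ((tendsto_pow_atTop_atTop_of_one_lt hq).eventually_gt_atTop
    (1 / Q (t • v))).exists
  rw [div_lt_iff₀ hQ1] at hk
  linarith [hgrow k, (hball (show dist (T^[k] (z + t • v)) z < η by
    simpa [dist_eq_norm] using hst' k)).2]

theorem exists_coercive_of_pos {E : Type*} [NormedAddCommGroup E] [NormedSpace ℝ E]
    [FiniteDimensional ℝ E] {Q : E → ℝ} (hQc : Continuous Q)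
    (hQh : ∀ (t : ℝ) v, Q (t • v) = t ^ 2 * Q v) (hpos : ∀ v, v ≠ 0 → 0 < Q v) :
    ∃ c > 0, ∀ v, c * ‖v‖ ^ 2 ≤ Q v := by
  have hQ0 : Q 0 = 0 := by simpa using hQh 0 0
  obtain ⟨c, hc, h⟩ := (isCompact_sphere (0 : E) 1).exists_forall_le' (f := Q) (a := 0)
    hQc.continuousOn (fun v hv => hpos v (by rintro rfl; simp at hv))
  refine ⟨c, hc, fun v => ?_⟩
  by_cases hv : v = 0
  · simp [hv, hQ0]
  · have hn : 0 < ‖v‖ := norm_pos_iff.mpr hv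
    have h1 := h (‖v‖⁻¹ • v) (by simp [norm_smul, hn.ne'])
    rw [hQh, inv_pow, le_inv_mul_iff₀ (by positivity)] at h1
    linarith

/-- Second-order sufficient condition for a local minimum along a linear subspace. -/
theorem eventually_le_add_of_hessian_pos {E Z : Type*} [NormedAddCommGroup E] [NormedSpace ℝ E]
    [FiniteDimensional ℝ E] [NormedAddCommGroup Z] [NormedSpace ℝ Z] {φ : Z → ℝ}
    (hφ : ContDiff ℝ 2 φ) {z : Z} (hz : fderiv ℝ φ z = 0) (L : E →L[ℝ] Z)
    (hpos : ∀ v, v ≠ 0 → 0 < fderiv ℝ (fderiv ℝ φ) z (L v) (L v)) :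
    ∀ᶠ v in 𝓝 (0 : E), φ z ≤ φ (z + L v) := by
  obtain ⟨c, hc, hcoer⟩ := exists_coercive_of_pos
    (Q := fun v => fderiv ℝ (fderiv ℝ φ) z (L v) (L v)) (by fun_prop)
    (fun t v => by simp only [map_smul, _root_.smul_apply, smul_eq_mul]; ring) hpos
  have hφ1 : Differentiable ℝ φ := hφ.differentiable (by norm_num)
  have hφ2 : Differentiable ℝ (fderiv ℝ φ) :=
    (hφ.fderiv_right (m := 1) (by norm_num)).differentiable (by norm_num)
  set ε := c / (‖L‖ ^ 2 + 1) with hεdef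
  have hε : 0 < ε := by positivity
  have hεL : ε * ‖L‖ ^ 2 ≤ c := by
    rw [hεdef, div_mul_eq_mul_div, div_le_iff₀ (by positivity)]
    nlinarith
  obtain ⟨r, hr, hball⟩ := Metric.eventually_nhds_iff.mp ((hφ2 z).hasFDerivAt.isLittleO.def hε)
  have hL : ∀ᶠ v in 𝓝 (0 : E), ‖L v‖ < r := by
    have : ContinuousAt (fun v => ‖L v‖) 0 := by fun_prop
    exact this.eventually_lt continuousAt_const (by simpa using hr)
  filter_upwards [hL] with v hv
  have hd : ∀ t : ℝ, HasDerivAt (fun t : ℝ => φ (z + t • L v))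
      (fderiv ℝ φ (z + t • L v) (L v)) t := by
    intro t
    have h1 : HasDerivAt (fun t : ℝ => z + t • L v) (L v) t := by
      simpa using ((hasDerivAt_id t).smul_const (L v)).const_add z
    exact (hφ1 _).hasFDerivAt.comp_hasDerivAt t h1
  have hmono : MonotoneOn (fun t : ℝ => φ (z + t • L v)) (Set.Icc 0 1) := by
    refine monotoneOn_of_deriv_nonneg (convex_Icc 0 1)
      (fun t _ => (hd t).continuousAt.continuousWithinAt)
      (fun t _ => (hd t).differentiableAt.differentiableWithinAt) fun t ht => ?_
    rw [interior_Icc] at ht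
    rw [(hd t).deriv]
    have h1 := @hball (z + t • L v) (by
      rw [dist_eq_norm, add_sub_cancel_left, norm_smul, Real.norm_of_nonneg ht.1.le]
      nlinarith [norm_nonneg (L v), ht.1, ht.2])
    rw [hz, sub_zero, add_sub_cancel_left] at h1
    have h2 := ((fderiv ℝ φ (z + t • L v) -
      fderiv ℝ (fderiv ℝ φ) z (t • L v)).le_of_opNorm_le h1 (L v))
    rw [Real.norm_eq_abs, _root_.sub_apply, map_smul,
      _root_.smul_apply, smul_eq_mul, norm_smul, Real.norm_of_nonneg ht.1.le] at h2
    have h3 := (abs_le.mp h2).1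
    have h4 := mul_le_mul_of_nonneg_left (hcoer v) ht.1.le
    have h5 : ‖L v‖ ^ 2 ≤ ‖L‖ ^ 2 * ‖v‖ ^ 2 := by
      rw [← mul_pow]
      exact pow_le_pow_left₀ (norm_nonneg _) (L.le_opNorm v) 2
    have h6 : ε * ‖L v‖ ^ 2 ≤ c * ‖v‖ ^ 2 := by
      have := mul_le_mul_of_nonneg_left h5 hε.le
      have := mul_le_mul_of_nonneg_right hεL (sq_nonneg ‖v‖)
      linarith
    have h7 := mul_le_mul_of_nonneg_left h6 ht.1.le
    linarith
  simpa using hmono (Set.left_mem_Icc.mpr zero_le_one) (Set.right_mem_Icc.mpr zero_le_one)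
    zero_le_one

theorem HasFDerivAt.continuousAt_mul_of_eq_zero {Z : Type*} [NormedAddCommGroup Z]
    [NormedSpace ℝ Z] {k g : Z → ℝ} {g' : Z →L[ℝ] ℝ} {z : Z} (hk : ContinuousAt k z)
    (hg : HasFDerivAt g g' z) (hgz : g z = 0) :
    HasFDerivAt (fun u => k u * g u) (k z • g') z := by
  rw [hasFDerivAt_iff_isLittleO] at hg ⊢
  have h1 : (fun u => k u * (g u - g z - g' (u - z))) =o[𝓝 z] fun u => u - z := by
    have := (hk.isBigO_one ℝ).mul_isLittleO hg.norm_right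
    simp only [one_mul] at this
    exact this.of_norm_right
  have h2 : (fun u => (k u - k z) * g' (u - z)) =o[𝓝 z] fun u => u - z := by
    have hk0 : (fun u => k u - k z) =o[𝓝 z] fun _ => (1 : ℝ) :=
      (Asymptotics.isLittleO_one_iff ℝ).mpr (by simpa using hk.tendsto.sub_const (k z))
    have := hk0.mul_isBigO (g'.isBigO_sub (𝓝 z) z).norm_right
    simp only [one_mul] at this
    exact this.of_norm_right
  refine (h1.add h2).congr_left fun u => ?_
  simp only [hgz, _root_.smul_apply, smul_eq_mul]
  ring

/-- The joint space of the variables `(x, y)`. -/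
abbrev PairSpace (nx ny : ℕ) := EuclideanSpace ℝ (Fin nx) × EuclideanSpace ℝ (Fin ny)

/-- The standard basis vectors of the joint space. -/
def pairBasis (nx ny : ℕ) : Fin nx ⊕ Fin ny → PairSpace nx ny :=
  Sum.elim (fun i => (EuclideanSpace.single i 1, 0)) (fun j => (0, EuclideanSpace.single j 1))

/-- The coordinates of a point of the joint space. -/
def pairCoords (p : PairSpace nx ny) : Fin nx ⊕ Fin ny → ℝ :=
  Sum.elim (fun i => p.1 i) (fun j => p.2 j)

/-- The point of the joint space with given coordinates. -/
def ofPairCoords (nx ny : ℕ) : (Fin nx ⊕ Fin ny → ℝ) →L[ℝ] PairSpace nx ny :=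
  LinearMap.toContinuousLinearMap
    { toFun := fun d => (WithLp.toLp 2 fun i => d (Sum.inl i), WithLp.toLp 2 fun j => d (Sum.inr j))
      map_add' := fun _ _ => rfl
      map_smul' := fun _ _ => rfl }

theorem pairCoords_ofPairCoords (d : Fin nx ⊕ Fin ny → ℝ) :
    pairCoords (ofPairCoords nx ny d) = d := by
  ext (i | j) <;> rfl

theorem pairCoords_sub (p r : PairSpace nx ny) :
    pairCoords (p - r) = pairCoords p - pairCoords r := by
  ext (i | j) <;> rfl

theorem sum_pairCoords_smul_pairBasis (p : PairSpace nx ny) :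
    ∑ a, pairCoords p a • pairBasis nx ny a = p := by
  rw [Fintype.sum_sum_type]
  refine Prod.ext ?_ ?_
  · ext i
    simp [pairCoords, pairBasis, Prod.fst_sum, Finset.sum_apply, Pi.single_apply]
  · ext i
    simp [pairCoords, pairBasis, Prod.snd_sum, Finset.sum_apply, Pi.single_apply]

theorem fderiv_comp_prodMk_left {X Y : Type*} [NormedAddCommGroup X] [NormedSpace ℝ X]
    [NormedAddCommGroup Y] [NormedSpace ℝ Y] {G : X × Y → ℝ} (hG : Differentiable ℝ G)
    (x : X) (y : Y) (v : X) :
    fderiv ℝ (fun x' => G (x', y)) x v = fderiv ℝ G (x, y) (v, 0) := by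
  have h : HasFDerivAt (fun x' => G (x', y)) _ x :=
    (hG (x, y)).hasFDerivAt.comp x (hasFDerivAt_prodMk_left x y)
  rw [h.fderiv]
  rfl

theorem fderiv_comp_prodMk_right {X Y : Type*} [NormedAddCommGroup X] [NormedSpace ℝ X]
    [NormedAddCommGroup Y] [NormedSpace ℝ Y] {G : X × Y → ℝ} (hG : Differentiable ℝ G)
    (x : X) (y : Y) (v : Y) :
    fderiv ℝ (fun y' => G (x, y')) y v = fderiv ℝ G (x, y) (0, v) := by
  have h : HasFDerivAt (fun y' => G (x, y')) _ y :=
    (hG (x, y)).hasFDerivAt.comp y (hasFDerivAt_prodMk_right x y)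
  rw [h.fderiv]
  rfl

section Calculus

variable {f : EuclideanSpace ℝ (Fin nx) → EuclideanSpace ℝ (Fin ny) → ℝ}

theorem pdX_eq_fderiv (hf : Differentiable ℝ fun p : PairSpace nx ny => f p.1 p.2)
    (x : EuclideanSpace ℝ (Fin nx)) (y : EuclideanSpace ℝ (Fin ny)) (i : Fin nx) :
    pdX f x y i =
      fderiv ℝ (fun p : PairSpace nx ny => f p.1 p.2) (x, y) (pairBasis nx ny (Sum.inl i)) :=
  fderiv_comp_prodMk_left hf x y _

theorem pdY_eq_fderiv (hf : Differentiable ℝ fun p : PairSpace nx ny => f p.1 p.2)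
    (x : EuclideanSpace ℝ (Fin nx)) (y : EuclideanSpace ℝ (Fin ny)) (j : Fin ny) :
    pdY f x y j =
      fderiv ℝ (fun p : PairSpace nx ny => f p.1 p.2) (x, y) (pairBasis nx ny (Sum.inr j)) :=
  fderiv_comp_prodMk_right hf x y _

theorem sumElim_pd_eq_fderiv (hf : Differentiable ℝ fun p : PairSpace nx ny => f p.1 p.2)
    (p : PairSpace nx ny) (a : Fin nx ⊕ Fin ny) :
    Sum.elim (fun i => pdX f p.1 p.2 i) (fun j => pdY f p.1 p.2 j) a =
      fderiv ℝ (fun p : PairSpace nx ny => f p.1 p.2) p (pairBasis nx ny a) := by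
  rcases a with i | j
  · exact pdX_eq_fderiv hf _ _ _
  · exact pdY_eq_fderiv hf _ _ _

theorem differentiable_fderiv_of_contDiff_two {E : Type*} [NormedAddCommGroup E]
    [NormedSpace ℝ E] {φ : E → ℝ} (hφ : ContDiff ℝ 2 φ) : Differentiable ℝ (fderiv ℝ φ) :=
  (hφ.fderiv_right (m := 1) (by norm_num)).differentiable (by norm_num)

theorem Hzz_eq_fderiv_fderiv (hf : ContDiff ℝ 2 fun p : PairSpace nx ny => f p.1 p.2)
    (p : PairSpace nx ny) (a b : Fin nx ⊕ Fin ny) :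
    Hzz f p.1 p.2 a b =
      fderiv ℝ (fderiv ℝ fun p : PairSpace nx ny => f p.1 p.2) p
        (pairBasis nx ny a) (pairBasis nx ny b) := by
  have h1 : Differentiable ℝ fun p : PairSpace nx ny => f p.1 p.2 :=
    hf.differentiable (by norm_num)
  have h2 := differentiable_fderiv_of_contDiff_two hf
  have h3 : ∀ v, Differentiable ℝ fun p => fderiv ℝ (fun p : PairSpace nx ny => f p.1 p.2) p v :=
    fun v => h2.clm_apply (differentiable_const v)
  have h4 : ∀ v w, fderiv ℝ (fun p => fderiv ℝ (fun p : PairSpace nx ny => f p.1 p.2) p v) p w =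
      fderiv ℝ (fderiv ℝ fun p : PairSpace nx ny => f p.1 p.2) p w v := by
    intro v w
    rw [((h2 p).hasFDerivAt.clm_apply (hasFDerivAt_const v p)).fderiv]
    simp
  rw [← h4]
  rcases a with i | i <;> rcases b with j | j <;>
    simp only [Hzz, fromBlocks_apply₁₁, fromBlocks_apply₁₂, fromBlocks_apply₂₁,
      fromBlocks_apply₂₂, Hxx, Hxy, Hyx, Hyy, of_apply, pdX_eq_fderiv h1, pdY_eq_fderiv h1]
  · exact fderiv_comp_prodMk_left (h3 _) p.1 p.2 _
  · exact fderiv_comp_prodMk_left (h3 _) p.1 p.2 _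
  · exact fderiv_comp_prodMk_right (h3 _) p.1 p.2 _
  · exact fderiv_comp_prodMk_right (h3 _) p.1 p.2 _

theorem Hzz_comm (hf : ContDiff ℝ 2 fun p : PairSpace nx ny => f p.1 p.2)
    (p : PairSpace nx ny) (a b : Fin nx ⊕ Fin ny) :
    Hzz f p.1 p.2 a b = Hzz f p.1 p.2 b a := by
  rw [Hzz_eq_fderiv_fderiv hf, Hzz_eq_fderiv_fderiv hf]
  exact (hf.contDiffAt.isSymmSndFDerivAt (by simp)).eq _ _

theorem Hxx_isHermitian (hf : ContDiff ℝ 2 fun p : PairSpace nx ny => f p.1 p.2)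
    (p : PairSpace nx ny) : (Hxx f p.1 p.2).IsHermitian := by
  ext i j
  exact Hzz_comm hf p (Sum.inl j) (Sum.inl i)

theorem Hyy_isHermitian (hf : ContDiff ℝ 2 fun p : PairSpace nx ny => f p.1 p.2)
    (p : PairSpace nx ny) : (Hyy f p.1 p.2).IsHermitian := by
  ext i j
  exact Hzz_comm hf p (Sum.inr j) (Sum.inr i)

theorem Hyx_eq_transpose (hf : ContDiff ℝ 2 fun p : PairSpace nx ny => f p.1 p.2)
    (p : PairSpace nx ny) : Hyx f p.1 p.2 = (Hxy f p.1 p.2)ᵀ := by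
  ext i j
  exact Hzz_comm hf p (Sum.inr i) (Sum.inl j)

theorem continuous_Hzz (hf : ContDiff ℝ 2 fun p : PairSpace nx ny => f p.1 p.2) :
    Continuous fun p : PairSpace nx ny => Hzz f p.1 p.2 := by
  refine continuous_matrix fun a b => ?_
  simp only [Hzz_eq_fderiv_fderiv hf]
  have : Continuous (fderiv ℝ (fderiv ℝ fun p : PairSpace nx ny => f p.1 p.2)) :=
    (hf.fderiv_right (m := 1) (by norm_num)).continuous_fderiv (by norm_num)
  fun_prop

theorem fderiv_fderiv_pairBasis (hf : ContDiff ℝ 2 fun p : PairSpace nx ny => f p.1 p.2)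
    (p v : PairSpace nx ny) (a : Fin nx ⊕ Fin ny) :
    fderiv ℝ (fderiv ℝ fun p : PairSpace nx ny => f p.1 p.2) p v (pairBasis nx ny a) =
      (Hzz f p.1 p.2 *ᵥ pairCoords v) a := by
  conv_lhs => rw [← sum_pairCoords_smul_pairBasis v]
  simp only [map_sum, map_smul, _root_.sum_apply, _root_.smul_apply, smul_eq_mul,
    mulVec, dotProduct, ← Hzz_eq_fderiv_fderiv hf]
  exact Finset.sum_congr rfl fun b _ => by rw [Hzz_comm hf, mul_comm]

theorem fderiv_fderiv_apply (hf : ContDiff ℝ 2 fun p : PairSpace nx ny => f p.1 p.2)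
    (p v w : PairSpace nx ny) :
    fderiv ℝ (fderiv ℝ fun p : PairSpace nx ny => f p.1 p.2) p v w =
      pairCoords w ⬝ᵥ Hzz f p.1 p.2 *ᵥ pairCoords v := by
  conv_lhs => rw [← sum_pairCoords_smul_pairBasis w]
  simp only [map_sum, map_smul, smul_eq_mul, dotProduct, fderiv_fderiv_pairBasis hf]

theorem fderiv_eq_zero_of_gradient_eq_zero
    (hf : Differentiable ℝ fun p : PairSpace nx ny => f p.1 p.2)
    {xs : EuclideanSpace ℝ (Fin nx)} {ys : EuclideanSpace ℝ (Fin ny)}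
    (hgradx : gradient (fun x' => f x' ys) xs = 0)
    (hgrady : gradient (fun y' => f xs y') ys = 0) :
    fderiv ℝ (fun p : PairSpace nx ny => f p.1 p.2) (xs, ys) = 0 := by
  have hx : fderiv ℝ (fun x' => f x' ys) xs = 0 := by
    simpa [gradient] using hgradx
  have hy : fderiv ℝ (fun y' => f xs y') ys = 0 := by
    simpa [gradient] using hgrady
  ext v
  · have := fderiv_comp_prodMk_left hf xs ys v
    simp only [hx, _root_.zero_apply] at this
    simpa using this.symm
  · have := fderiv_comp_prodMk_right hf xs ys v
    simp only [hy, _root_.zero_apply] at this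
    simpa using this.symm

end Calculus

theorem Matrix.IsHermitian.exists_eigenvector_neg {n : Type*} [Fintype n] [DecidableEq n]
    {S : Matrix n n ℝ} (hS : S.IsHermitian) (hdet : IsUnit S.det) (hpos : ¬ S.PosDef) :
    ∃ v ≠ 0, ∃ μ < (0 : ℝ), S *ᵥ v = μ • v := by
  rw [hS.posDef_iff_eigenvalues_pos] at hpos
  push Not at hpos
  obtain ⟨i, hi⟩ := hpos
  refine ⟨WithLp.ofLp (hS.eigenvectorBasis i), ?_, hS.eigenvalues i, lt_of_le_of_ne hi ?_,
    hS.mulVec_eigenvectorBasis i⟩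
  · simpa using hS.eigenvectorBasis.toBasis.ne_zero i
  · intro h
    rw [hS.det_eq_prod_eigenvalues] at hdet
    refine hdet.ne_zero (Finset.prod_eq_zero (Finset.mem_univ i) ?_)
    simp [h]

theorem isHermitian_schur {m n : ℕ} {A : Matrix (Fin m) (Fin m) ℝ}
    {B : Matrix (Fin m) (Fin n) ℝ} {D : Matrix (Fin n) (Fin n) ℝ} (hA : A.IsHermitian)
    (hD : D.IsHermitian) : (A - B * D⁻¹ * Bᵀ).IsHermitian := by
  refine hA.sub ?_
  have := isHermitian_mul_mul_conjTranspose B hD.inv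
  rwa [conjTranspose_eq_transpose_of_trivial] at this

theorem hasExpandingForm_of_not_posDef {m n : ℕ} {A : Matrix (Fin m) (Fin m) ℝ}
    {B : Matrix (Fin m) (Fin n) ℝ} {D : Matrix (Fin n) (Fin n) ℝ} (hA : A.IsHermitian)
    (hD : D.IsHermitian) (hdet : IsUnit (Matrix.fromBlocks A B Bᵀ D).det) (hDdet : IsUnit D.det)
    (h : ¬ ((-D).PosDef ∧ (A - B * D⁻¹ * Bᵀ).PosDef)) : HasExpandingForm A B D := by
  by_cases hneg : (-D).PosDef
  · have hSdet : IsUnit (A - B * D⁻¹ * Bᵀ).det := by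
      let := invertibleOfIsUnitDet D hDdet
      rw [det_fromBlocks₂₂, invOf_eq_nonsing_inv] at hdet
      exact isUnit_of_mul_isUnit_right hdet
    obtain ⟨v, hv, μ, hμ, hSv⟩ := (isHermitian_schur hA hD).exists_eigenvector_neg hSdet
      fun hS => h ⟨hneg, hS⟩
    exact hasExpandingForm_of_schur hA hneg hv hμ hSv
  · obtain ⟨v, hv, μ, hμ, hDv⟩ := hD.neg.exists_eigenvector_neg
      (by rw [det_neg]; exact ((isUnit_one.neg).pow _).mul hDdet) hneg
    refine hasExpandingForm_of_eigenvalue_pos hA hD hv (neg_pos.mpr hμ) ?_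
    rw [neg_mulVec] at hDv
    rw [neg_smul, ← hDv, neg_neg]

/-- The response `y = -D⁻¹ Bᵀ x` maximising the quadratic model, as a map into the joint space. -/
def schurResponse (B : Matrix (Fin nx) (Fin ny) ℝ) (D : Matrix (Fin ny) (Fin ny) ℝ) :
    EuclideanSpace ℝ (Fin nx) →L[ℝ] PairSpace nx ny :=
  (ContinuousLinearMap.id ℝ _).prod
    (LinearMap.toContinuousLinearMap (-(toEuclideanLin (D⁻¹ * Bᵀ))))

section MinMax

variable {f : EuclideanSpace ℝ (Fin nx) → EuclideanSpace ℝ (Fin ny) → ℝ}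

theorem fderiv_fderiv_schurResponse (hf : ContDiff ℝ 2 fun p : PairSpace nx ny => f p.1 p.2)
    (p : PairSpace nx ny) (hD : IsUnit (Hyy f p.1 p.2).det) (x : EuclideanSpace ℝ (Fin nx)) :
    fderiv ℝ (fderiv ℝ fun p : PairSpace nx ny => f p.1 p.2) p
        (schurResponse (Hxy f p.1 p.2) (Hyy f p.1 p.2) x)
        (schurResponse (Hxy f p.1 p.2) (Hyy f p.1 p.2) x) =
      x.ofLp ⬝ᵥ (Hxx f p.1 p.2 - Hxy f p.1 p.2 * (Hyy f p.1 p.2)⁻¹ * (Hxy f p.1 p.2)ᵀ) *ᵥ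
        x.ofLp := by
  rw [fderiv_fderiv_apply hf, Hzz, Hyx_eq_transpose hf]
  set A := Hxx f p.1 p.2
  set B := Hxy f p.1 p.2
  set D := Hyy f p.1 p.2
  have hc : pairCoords (schurResponse B D x) = Sum.elim x.ofLp (-((D⁻¹ * Bᵀ) *ᵥ x.ofLp)) := rfl
  rw [hc, fromBlocks_mulVec, sumElim_dotProduct_sumElim]
  have h0 : Bᵀ *ᵥ x.ofLp + D *ᵥ (-((D⁻¹ * Bᵀ) *ᵥ x.ofLp)) = 0 := by
    rw [mulVec_neg, mulVec_mulVec, ← Matrix.mul_assoc, mul_nonsing_inv _ hD, Matrix.one_mul,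
      add_neg_cancel]
  simp only [Function.comp_def, Sum.elim_inl, Sum.elim_inr, h0, dotProduct_zero, add_zero]
  rw [mulVec_neg, mulVec_mulVec, ← sub_eq_add_neg, sub_mulVec, Matrix.mul_assoc]

theorem fderiv_fderiv_inr (hf : ContDiff ℝ 2 fun p : PairSpace nx ny => f p.1 p.2)
    (p : PairSpace nx ny) (y : EuclideanSpace ℝ (Fin ny)) :
    fderiv ℝ (fderiv ℝ fun p : PairSpace nx ny => f p.1 p.2) p
        (ContinuousLinearMap.inr ℝ _ _ y) (ContinuousLinearMap.inr ℝ _ _ y) =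
      y.ofLp ⬝ᵥ Hyy f p.1 p.2 *ᵥ y.ofLp := by
  have hc : pairCoords (nx := nx) (ContinuousLinearMap.inr ℝ _ _ y) =
      Sum.elim (0 : Fin nx → ℝ) y.ofLp := rfl
  rw [fderiv_fderiv_apply hf, Hzz, hc, fromBlocks_mulVec, sumElim_dotProduct_sumElim,
    Sum.elim_comp_inl, Sum.elim_comp_inr]
  simp

theorem isLocalMinMax_of_posDef_schur (hf : ContDiff ℝ 2 fun p : PairSpace nx ny => f p.1 p.2)
    {xs : EuclideanSpace ℝ (Fin nx)} {ys : EuclideanSpace ℝ (Fin ny)}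
    (hz : fderiv ℝ (fun p : PairSpace nx ny => f p.1 p.2) (xs, ys) = 0)
    (hdet : IsUnit (Hyy f xs ys).det) (hD : (-Hyy f xs ys).PosDef)
    (hS : (Hxx f xs ys - Hxy f xs ys * (Hyy f xs ys)⁻¹ * (Hxy f xs ys)ᵀ).PosDef) :
    IsLocalMinMax f xs ys := by
  set L := schurResponse (Hxy f xs ys) (Hyy f xs ys)
  have hx : ∀ᶠ v in 𝓝 (0 : EuclideanSpace ℝ (Fin nx)),
      f xs ys ≤ f (xs + v) (ys + (L v).2) :=
    eventually_le_add_of_hessian_pos hf hz L fun v hv => by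
      rw [fderiv_fderiv_schurResponse hf (xs, ys) hdet]
      simpa using hS.dotProduct_mulVec_pos (x := v.ofLp) (by simpa using hv)
  have hy : ∀ᶠ w in 𝓝 (0 : EuclideanSpace ℝ (Fin ny)), f xs (ys + w) ≤ f xs ys := by
    have := eventually_le_add_of_hessian_pos (φ := fun p : PairSpace nx ny => -f p.1 p.2) hf.neg
      (z := (xs, ys)) (by rw [fderiv_fun_neg, hz, neg_zero]) (ContinuousLinearMap.inr ℝ _ _)
      fun w hw => by
        have h1 : fderiv ℝ (fun p : PairSpace nx ny => -f p.1 p.2) =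
            fun p => -fderiv ℝ (fun p : PairSpace nx ny => f p.1 p.2) p :=
          funext fun p => fderiv_fun_neg
        have h2 := fderiv_fderiv_inr hf (xs, ys) w
        have h3 := hD.dotProduct_mulVec_pos (x := w.ofLp) (by simpa using hw)
        simp only [star_trivial, neg_mulVec, dotProduct_neg] at h3
        rw [h1, fderiv_fun_neg]
        simpa only [_root_.neg_apply, h2] using h3
    filter_upwards [this] with w hw
    simpa using hw
  obtain ⟨r₁, hr₁, hx⟩ := Metric.eventually_nhds_iff.mp hx
  obtain ⟨r₂, hr₂, hy⟩ := Metric.eventually_nhds_iff.mp hy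
  simp only [dist_zero_right] at hx hy
  have hL : 0 < ‖L‖ + 1 := by positivity
  refine ⟨min (r₁ / 2) (r₂ / (2 * (‖L‖ + 1))), by positivity, fun δ => (‖L‖ + 1) * δ,
    fun δ hδ => mul_pos hL hδ.1, ?_, fun δ hδ x y hxδ hyδ => ⟨?_, ys + (L (x - xs)).2, ?_, ?_⟩⟩
  · have : Continuous fun δ : ℝ => (‖L‖ + 1) * δ := by fun_prop
    simpa using (this.tendsto 0).mono_left nhdsWithin_le_nhds
  · have h1 := hδ.2.trans (min_le_right _ _)
    rw [le_div_iff₀ (by positivity)] at h1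
    simpa using hy (y := y - ys) (by linarith)
  · rw [add_sub_cancel_left]
    refine (norm_snd_le _).trans ((L.le_opNorm _).trans ?_)
    exact mul_le_mul (by linarith) hxδ (norm_nonneg _) hL.le
  · have h1 := hδ.2.trans (min_le_left _ _)
    simpa using hx (y := x - xs) (by linarith)

end MinMax

theorem Emod_eq_fromBlocks (c e : ℝ) :
    Emod nx ny c e = Matrix.fromBlocks (c • 1) 0 0 (-(e • 1)) := by
  ext (i | i) (j | j) <;> simp [Emod, diagonal_apply, one_apply]
  split_ifs <;> simp

theorem pairCoords_eq (p : PairSpace nx ny) : pairCoords p = Sum.elim p.1.ofLp p.2.ofLp := rfl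

theorem isUnit_det_fromBlocks_of_posDef {m n : ℕ} {A : Matrix (Fin m) (Fin m) ℝ}
    {B : Matrix (Fin m) (Fin n) ℝ} {D : Matrix (Fin n) (Fin n) ℝ} (hA : A.PosDef)
    (hD : (-D).PosDef) : IsUnit (Matrix.fromBlocks A B Bᵀ D).det := by
  obtain ⟨hW, -, -, h0⟩ := hasInertia_fromBlocks (B := B) hA hD
  rw [hW.det_eq_prod_eigenvalues, isUnit_iff_ne_zero, Finset.prod_ne_zero_iff]
  intro i _ hi
  rw [Nat.card_eq_zero] at h0
  rcases h0 with h0 | h0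
  · exact h0.elim ⟨i, by simpa using hi⟩
  · exact h0.not_finite inferInstance

section Iteration

variable {f : EuclideanSpace ℝ (Fin nx) → EuclideanSpace ℝ (Fin ny) → ℝ}

theorem newtonMinMaxMap_eq_sub (hf : Differentiable ℝ fun p : PairSpace nx ny => f p.1 p.2)
    (εx εy : PairSpace nx ny → ℝ) (p : PairSpace nx ny) :
    newtonMinMaxMap f εx εy p = p - ofPairCoords nx ny
      ((Hzz f p.1 p.2 + Emod nx ny (εx p) (εy p))⁻¹ *ᵥ fun a =>
        fderiv ℝ (fun p : PairSpace nx ny => f p.1 p.2) p (pairBasis nx ny a)) := by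
  rw [← funext (sumElim_pd_eq_fderiv hf p)]
  rfl

/-- At a critical point the modified Newton map is differentiable, with derivative `J` satisfying
`(H + E) J = E`. -/
theorem exists_hasFDerivAt_newtonMinMaxMap
    (hf : ContDiff ℝ 2 fun p : PairSpace nx ny => f p.1 p.2) (c e : ℝ) {z : PairSpace nx ny}
    (hz : fderiv ℝ (fun p : PairSpace nx ny => f p.1 p.2) z = 0)
    (hW : IsUnit (Hzz f z.1 z.2 + Emod nx ny c e).det) :
    ∃ J : PairSpace nx ny →L[ℝ] PairSpace nx ny,
      HasFDerivAt (newtonMinMaxMap f (fun _ => c) fun _ => e) J z ∧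
      ∀ d, (Hzz f z.1 z.2 + Emod nx ny c e) *ᵥ pairCoords (J d) =
        Emod nx ny c e *ᵥ pairCoords d := by
  have hf1 : Differentiable ℝ fun p : PairSpace nx ny => f p.1 p.2 :=
    hf.differentiable (by norm_num)
  set φ : PairSpace nx ny → ℝ := fun p => f p.1 p.2 with hφ
  set W : PairSpace nx ny → Matrix (Fin nx ⊕ Fin ny) (Fin nx ⊕ Fin ny) ℝ :=
    fun p => Hzz f p.1 p.2 + Emod nx ny c e with hWdef
  have hWc : Continuous W := (continuous_Hzz hf).add continuous_const
  have hinv : ∀ a b, ContinuousAt (fun p => (W p)⁻¹ a b) z := by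
    intro a b
    simp only [inv_def, Ring.inverse_eq_inv', Matrix.smul_apply, smul_eq_mul]
    exact (hWc.matrix_det.continuousAt.inv₀ hW.ne_zero).mul
      (hWc.matrix_adjugate.matrix_elem a b).continuousAt
  have hg : ∀ b, HasFDerivAt (fun p => fderiv ℝ φ p (pairBasis nx ny b))
      ((fderiv ℝ (fderiv ℝ φ) z).flip (pairBasis nx ny b)) z := fun b => by
    have := ((differentiable_fderiv_of_contDiff_two hf) z).hasFDerivAt.clm_apply
      (hasFDerivAt_const (pairBasis nx ny b) z)
    simpa using this
  have hd : HasFDerivAt (fun p => (W p)⁻¹ *ᵥ fun a => fderiv ℝ φ p (pairBasis nx ny a))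
      (ContinuousLinearMap.pi fun a => ∑ b, (W z)⁻¹ a b •
        (fderiv ℝ (fderiv ℝ φ) z).flip (pairBasis nx ny b)) z := by
    refine hasFDerivAt_pi.mpr fun a => ?_
    simp only [mulVec, dotProduct]
    exact HasFDerivAt.fun_sum fun b _ =>
      HasFDerivAt.continuousAt_mul_of_eq_zero (hinv a b) (hg b) (by simp [hz])
  have hT := (hasFDerivAt_id (𝕜 := ℝ) z).sub ((ofPairCoords nx ny).hasFDerivAt.comp z hd)
  refine ⟨_, hT.congr_of_eventuallyEq (.of_forall (newtonMinMaxMap_eq_sub hf1 _ _)), fun d => ?_⟩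
  have h : (ContinuousLinearMap.pi fun a => ∑ b, (W z)⁻¹ a b •
      (fderiv ℝ (fderiv ℝ φ) z).flip (pairBasis nx ny b)) d =
      (W z)⁻¹ *ᵥ (Hzz f z.1 z.2 *ᵥ pairCoords d) := by
    ext a
    simp [mulVec, dotProduct, hφ, fderiv_fderiv_pairBasis hf, _root_.sum_apply]
  rw [_root_.sub_apply, ContinuousLinearMap.comp_apply, h, pairCoords_sub,
    pairCoords_ofPairCoords, mulVec_sub, mulVec_mulVec, mul_nonsing_inv _ hW, one_mulVec]
  simp [add_mulVec]

theorem isUnstableFixedPt_newtonMinMaxMap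
    (hf : ContDiff ℝ 2 fun p : PairSpace nx ny => f p.1 p.2) {z : PairSpace nx ny}
    (hz : fderiv ℝ (fun p : PairSpace nx ny => f p.1 p.2) z = 0) {c e q : ℝ}
    (hW : IsUnit (Hzz f z.1 z.2 + Emod nx ny c e).det) (hq : 1 < q)
    {P₁ : Matrix (Fin nx) (Fin nx) ℝ} {P₂ : Matrix (Fin ny) (Fin ny) ℝ}
    (hpos : ∃ z₁ z₂, 0 < z₁ ⬝ᵥ P₁ *ᵥ z₁ + z₂ ⬝ᵥ P₂ *ᵥ z₂)
    (hexp : ∀ z₁ z₂ w₁ w₂,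
      Hxx f z.1 z.2 *ᵥ w₁ + c • w₁ + Hxy f z.1 z.2 *ᵥ w₂ = c • z₁ →
      (Hxy f z.1 z.2)ᵀ *ᵥ w₁ + Hyy f z.1 z.2 *ᵥ w₂ - e • w₂ = -(e • z₂) →
      ¬ (z₁ = 0 ∧ z₂ = 0) →
      q * (z₁ ⬝ᵥ P₁ *ᵥ z₁ + z₂ ⬝ᵥ P₂ *ᵥ z₂) < w₁ ⬝ᵥ P₁ *ᵥ w₁ + w₂ ⬝ᵥ P₂ *ᵥ w₂) :
    IsUnstableFixedPt (newtonMinMaxMap f (fun _ => c) fun _ => e) z := by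
  have hfix : newtonMinMaxMap f (fun _ => c) (fun _ => e) z = z := by
    rw [newtonMinMaxMap_eq_sub (hf.differentiable (by norm_num)), hz]
    simp [← Pi.zero_def]
  obtain ⟨J, hT, hJ⟩ := exists_hasFDerivAt_newtonMinMaxMap hf c e hz hW
  refine ⟨hfix, not_stableFixedPt_of_expanding_form hT hfix
    (Q := fun v => v.1.ofLp ⬝ᵥ P₁ *ᵥ v.1.ofLp + v.2.ofLp ⬝ᵥ P₂ *ᵥ v.2.ofLp) ?_ ?_ hq ?_ ?_⟩
  · simp only [dotProduct, mulVec]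
    fun_prop
  · intro t v
    simp only [Prod.smul_fst, Prod.smul_snd, WithLp.ofLp_smul, mulVec_smul, dotProduct_smul,
      smul_dotProduct, smul_eq_mul]
    ring
  · intro d hd
    have h := hJ d
    rw [Emod_eq_fromBlocks, Hzz, Hyx_eq_transpose hf, fromBlocks_add, pairCoords_eq,
      pairCoords_eq, fromBlocks_mulVec, fromBlocks_mulVec, Sum.elim_eq_iff] at h
    simp only [Sum.elim_comp_inl, Sum.elim_comp_inr, add_mulVec, smul_mulVec, one_mulVec,
      zero_mulVec, neg_mulVec, add_zero, zero_add] at h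
    refine hexp _ _ _ _ h.1 ?_ fun h0 => hd (Prod.ext (by simpa using h0.1) (by simpa using h0.2))
    rw [← h.2]
    abel
  · obtain ⟨z₁, z₂, h⟩ := hpos
    exact ⟨(WithLp.toLp 2 z₁, WithLp.toLp 2 z₂), h⟩

end Iteration

/-- **Theorem (instability part)**: at an equilibrium that is not a local minmax, there exist
modification functions `ε_x, ε_y`, constant near the equilibrium and satisfying the LQAC,
making the equilibrium unstable for the modified Newton iteration. -/
theorem newtonMinMax_unstable_of_not_localMinMax
    (f : EuclideanSpace ℝ (Fin nx) → EuclideanSpace ℝ (Fin ny) → ℝ)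
    (hf : ContDiff ℝ 2 (fun p : EuclideanSpace ℝ (Fin nx) × EuclideanSpace ℝ (Fin ny) =>
      f p.1 p.2))
    (xs : EuclideanSpace ℝ (Fin nx)) (ys : EuclideanSpace ℝ (Fin ny))
    (hgradx : gradient (fun x' => f x' ys) xs = 0)
    (hgrady : gradient (fun y' => f xs y') ys = 0)
    (hinvzz : IsUnit (Hzz f xs ys).det)
    (hinvyy : IsUnit (Hyy f xs ys).det)
    (hHdiff : ∀ᶠ p in 𝓝 (xs, ys), ∀ i j,
      DifferentiableAt ℝ
        (fun q : EuclideanSpace ℝ (Fin nx) × EuclideanSpace ℝ (Fin ny) => Hzz f q.1 q.2 i j) p)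
    (hminmax : ¬ IsLocalMinMax f xs ys) :
    ∃ εx εy : EuclideanSpace ℝ (Fin nx) × EuclideanSpace ℝ (Fin ny) → ℝ,
      (∀ p, 0 ≤ εx p) ∧ (∀ p, 0 ≤ εy p) ∧
      (∀ᶠ p in 𝓝 (xs, ys), εx p = εx (xs, ys) ∧ εy p = εy (xs, ys)) ∧
      LQAC f εx εy (xs, ys) ∧
      IsUnstableFixedPt (newtonMinMaxMap f εx εy) (xs, ys) := by
  have hz := fderiv_eq_zero_of_gradient_eq_zero (hf.differentiable (by norm_num)) hgradx hgrady
  have hyx := Hyx_eq_transpose hf (xs, ys)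
  rw [Hzz, hyx] at hinvzz
  obtain ⟨c, hc, e, he, hA, hD, q, hq, P₁, P₂, hpos, hexp⟩ :=
    hasExpandingForm_of_not_posDef (Hxx_isHermitian hf (xs, ys)) (Hyy_isHermitian hf (xs, ys))
      hinvzz hinvyy fun h => hminmax (isLocalMinMax_of_posDef_schur hf hz hinvyy h.1 h.2)
  have hHE : Hzz f xs ys + Emod nx ny c e = Matrix.fromBlocks (Hxx f xs ys + c • 1)
      (Hxy f xs ys) (Hxy f xs ys)ᵀ (Hyy f xs ys - e • 1) := by
    rw [Hzz, hyx, Emod_eq_fromBlocks, fromBlocks_add, add_zero, add_zero, sub_eq_add_neg]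
  refine ⟨fun _ => c, fun _ => e, fun _ => hc, fun _ => he, by simp,
    ⟨hasInertia_of_neg hD, ?_⟩, isUnstableFixedPt_newtonMinMaxMap hf hz ?_ hq hpos hexp⟩
  · exact hHE ▸ hasInertia_fromBlocks hA hD
  · exact hHE ▸ isUnit_det_fromBlocks_of_posDef hA hD
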